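/- arXiv:1403.1195 — 2 statements merged into one kernel-verified Lean document; each statement's English description precedes it below -/
import Mathlib

section
/- Let G be a group with a finite symmetric generating set S (e ∉ S) and let P be the lazy simple random walk measure. Assume there is c > 0 with |B_n| ≥ c·n³ for all n ≥ 1, and assume the interpolated off-diagonal estimate: there exist M, N > 0 such that for every ε ∈ [0,1], every g ∈ G and every n ≥ 1, P^{(n)}(g) ≤ P^{(n)}(e)^{1−ε}·N^ε·exp(−ε·M·|g|²/n). Write |B_n| = exp(f_V(n)), let f be the concave hull of f_V (the least concave function on [0,∞) dominating f_V on ℕ), and let F be the inverse function of the strictly increasing map x ↦ x²/f(x) on [1,∞). Then there exist constants K'', L'' > 0 such that for all sufficiently large n, P^{(n)}(e) ≥ K''·|B_{⌈F(L''·n)⌉}|^{−2}·F(L''·n)^{−1}. -/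
open scoped Classical

noncomputable section

/-- Word length of `g` with respect to the generating set `S`
(least `n` such that `g` is a product of `n` elements of `S`). -/
def wordLength {G : Type*} [Group G] (S : Set G) (g : G) : ℕ :=
  sInf {n | ∃ l : List G, (∀ x ∈ l, x ∈ S) ∧ l.length = n ∧ l.prod = g}

/-- The ball of radius `n` with respect to the generating set `S`. -/
def ball {G : Type*} [Group G] (S : Set G) (n : ℕ) : Set G :=
  {g | wordLength S g ≤ n}

/-- The lazy simple random walk measure `P = (1/2)(δ_e + U_S)`. -/
def lazyWalk {G : Type*} [Group G] (S : Finset G) : G → ℝ := fun g =>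
  (if g = 1 then (1 : ℝ) / 2 else 0) + (if g ∈ S then 1 / (2 * (S.card : ℝ)) else 0)

/-- The `n`-fold convolution power of a measure `P` (with `P^{(0)} = δ_e`). -/
def convPow {G : Type*} [Group G] (P : G → ℝ) : ℕ → G → ℝ
  | 0 => fun g => if g = 1 then 1 else 0
  | n + 1 => fun g => ∑' h : G, convPow P n h * P (h⁻¹ * g)

/-- The speed (expected word length) of the walk at time `n`. -/
def speed {G : Type*} [Group G] (S : Set G) (P : G → ℝ) (n : ℕ) : ℝ :=
  ∑' g : G, convPow P n g * (wordLength S g : ℝ)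

/-- The entropy of a measure `Q`, with the convention `0 · ln 0 = 0`. -/
def entropy {G : Type*} [Group G] (Q : G → ℝ) : ℝ :=
  -∑' g : G, Q g * Real.log (Q g)

/-- A real Hilbert space equipped with an isometric linear `G`-representation and
a cocycle for it: `b (x y) = λ(x) b(y) + b(x)`. -/
structure HilbertCocycle (G : Type*) [Group G] where
  space : Type
  [nacg : NormedAddCommGroup space]
  [ips : InnerProductSpace ℝ space]
  [complete : CompleteSpace space]
  rep : G →* (space ≃ₗᵢ[ℝ] space)
  cocycle : G → space
  cocycle_rel : ∀ x y : G, cocycle (x * y) = rep x (cocycle y) + cocycle x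

attribute [instance] HilbertCocycle.nacg HilbertCocycle.ips HilbertCocycle.complete

/-- The set of values at `x` of concave functions on `[0,∞)` dominating `f` on `ℕ`. -/
def concaveMajorants (f : ℕ → ℝ) (x : ℝ) : Set ℝ :=
  {y | ∃ h : ℝ → ℝ, ConcaveOn ℝ (Set.Ici 0) h ∧ (∀ k : ℕ, f k ≤ h k) ∧ y = h x}

/-- The concave hull of `f : ℕ → ℝ`: the pointwise infimum of concave majorants. -/
def concaveHull (f : ℕ → ℝ) (x : ℝ) : ℝ := sInf (concaveMajorants f x)

/-- The log-volume of the ball of radius `n`. -/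
def growthLog {G : Type*} [Group G] (S : Set G) (n : ℕ) : ℝ :=
  Real.log (Nat.card ↥(ball S n))

end

section ConcaveHull

variable {u : ℕ → ℝ}

theorem ConcaveOn.nonneg_of_nonneg_natCast {h : ℝ → ℝ} (hh : ConcaveOn ℝ (Set.Ici 0) h)
    (hk : ∀ k : ℕ, 0 ≤ h k) {x : ℝ} (hx : 0 ≤ x) : 0 ≤ h x := by
  have h1 : (0 : ℝ) ≤ (⌊x⌋₊ : ℝ) := Nat.cast_nonneg _
  have h2 : (0 : ℝ) ≤ (⌈x⌉₊ : ℝ) := Nat.cast_nonneg _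
  have := hh.min_le_of_mem_Icc (x := (⌊x⌋₊ : ℝ)) (y := (⌈x⌉₊ : ℝ)) h1 h2
    ⟨Nat.floor_le hx, Nat.le_ceil x⟩
  exact (le_min (hk _) (hk _)).trans this

theorem concaveMajorants_bddBelow (hu : ∀ k, 0 ≤ u k) {x : ℝ} (hx : 0 ≤ x) :
    BddBelow (concaveMajorants u x) := by
  refine ⟨0, ?_⟩
  rintro _ ⟨h, hc, hk, rfl⟩
  exact hc.nonneg_of_nonneg_natCast (fun k => (hu k).trans (hk k)) hx

theorem concaveMajorants_nonempty {C : ℝ} (hC : ∀ k, u k ≤ C * k) (x : ℝ) :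
    (concaveMajorants u x).Nonempty := by
  refine ⟨C * x, fun y => C * y, ⟨convex_Ici 0, ?_⟩, hC, rfl⟩
  intro a _ b _ s t _ _ _
  simp only [smul_eq_mul]
  exact le_of_eq (by ring)

theorem le_concaveHull_natCast {C : ℝ} (hC : ∀ k, u k ≤ C * k) (k : ℕ) :
    u k ≤ concaveHull u k := by
  refine le_csInf (concaveMajorants_nonempty hC _) ?_
  rintro _ ⟨h, -, hk, rfl⟩
  exact hk k

theorem concaveOn_concaveHull (hu : ∀ k, 0 ≤ u k) {C : ℝ} (hC : ∀ k, u k ≤ C * k) :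
    ConcaveOn ℝ (Set.Ici 0) (concaveHull u) := by
  refine ⟨convex_Ici 0, ?_⟩
  intro x hx y hy a b ha hb hab
  refine le_csInf (concaveMajorants_nonempty hC _) ?_
  rintro _ ⟨h, hc, hk, rfl⟩
  refine le_trans ?_ (hc.2 hx hy ha hb hab)
  have h1 : concaveHull u x ≤ h x := csInf_le (concaveMajorants_bddBelow hu hx) ⟨h, hc, hk, rfl⟩
  have h2 : concaveHull u y ≤ h y := csInf_le (concaveMajorants_bddBelow hu hy) ⟨h, hc, hk, rfl⟩
  simp only [smul_eq_mul]
  gcongr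

end ConcaveHull

section ConcaveQuotient

variable {f : ℝ → ℝ}

theorem ConcaveOn.mul_le_mul_of_le (hf : ConcaveOn ℝ (Set.Ici 0) f) (h0 : 0 ≤ f 0) {x y : ℝ}
    (hx : 0 < x) (hxy : x ≤ y) : x * f y ≤ y * f x := by
  have hy : 0 < y := hx.trans_le hxy
  have ht : 0 ≤ 1 - x / y := by
    rw [sub_nonneg, div_le_one hy]
    exact hxy
  have h := hf.2 (Set.mem_Ici.2 hy.le) (Set.mem_Ici.2 le_rfl) (div_nonneg hx.le hy.le) ht
    (by ring)
  simp only [smul_eq_mul, mul_zero, add_zero, div_mul_cancel₀ x hy.ne'] at h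
  have h' : x / y * f y ≤ f x := by nlinarith [mul_nonneg ht h0]
  calc x * f y = y * (x / y * f y) := by field_simp
    _ ≤ y * f x := by gcongr

theorem ConcaveOn.strictMonoOn_sq_div (hf : ConcaveOn ℝ (Set.Ici 0) f) (h0 : 0 ≤ f 0)
    (hpos : ∀ x, 1 ≤ x → 0 < f x) : StrictMonoOn (fun x => x ^ 2 / f x) (Set.Ici 1) := by
  intro x hx y hy hxy
  have hx0 : (0 : ℝ) < x := zero_lt_one.trans_le hx
  have hfx := hpos x hx
  change x ^ 2 / f x < y ^ 2 / f y
  rw [div_lt_div_iff₀ hfx (hpos y hy)]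
  have h := hf.mul_le_mul_of_le h0 hx0 hxy.le
  calc x ^ 2 * f y = x * (x * f y) := by ring
    _ ≤ x * (y * f x) := by gcongr
    _ = (x * y) * f x := by ring
    _ < y ^ 2 * f x := by
      gcongr
      nlinarith

theorem ConcaveOn.exists_sq_div_eq (hf : ConcaveOn ℝ (Set.Ici 0) f) (h0 : 0 ≤ f 0)
    (hpos : ∀ x, 1 ≤ x → 0 < f x) {y : ℝ} (hy : 1 / f 1 ≤ y) :
    ∃ x, 1 ≤ x ∧ x ^ 2 / f x = y := by
  have hf1 := hpos 1 le_rfl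
  have hy1 : 1 ≤ y * f 1 := by rwa [div_le_iff₀ hf1] at hy
  have hcont : ContinuousOn (fun x => x ^ 2 / f x) (Set.Icc 1 (y * f 1)) := by
    have hfc : ContinuousOn f (Set.Ioi 0) :=
      (hf.subset Set.Ioi_subset_Ici_self (convex_Ioi 0)).continuousOn isOpen_Ioi
    refine (continuousOn_id.pow 2).div (hfc.mono fun x hx => zero_lt_one.trans_le hx.1) ?_
    intro x hx
    exact (hpos x hx.1).ne'
  have hmem : y ∈ Set.Icc (1 ^ 2 / f 1) ((y * f 1) ^ 2 / f (y * f 1)) := by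
    refine ⟨by simpa using hy, ?_⟩
    rw [le_div_iff₀ (hpos _ hy1)]
    have h := hf.mul_le_mul_of_le h0 one_pos hy1
    have hy0 : 0 ≤ y := le_trans (by positivity) hy
    calc y * f (y * f 1) ≤ y * (y * f 1 * f 1) := by
          gcongr
          linarith
      _ = (y * f 1) ^ 2 := by ring
  obtain ⟨x, hx, hxy⟩ := intermediate_value_Icc hy1 hcont hmem
  exact ⟨x, hx.1, hxy⟩

end ConcaveQuotient

section WordLength

variable {G : Type*} [Group G]

theorem wordLength_one (S : Set G) : wordLength S 1 = 0 :=
  Nat.sInf_eq_zero.2 (Or.inl ⟨[], by simp, rfl, rfl⟩)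

theorem wordLength_le_one_of_mem {S : Set G} {s : G} (hs : s ∈ S) : wordLength S s ≤ 1 :=
  Nat.sInf_le ⟨[s], by simpa using hs, rfl, by simp⟩

theorem exists_list_prod_eq {S : Set G} (hsym : ∀ s ∈ S, s⁻¹ ∈ S)
    (hgen : Subgroup.closure S = ⊤) (g : G) : ∃ l : List G, (∀ x ∈ l, x ∈ S) ∧ l.prod = g := by
  have hg : g ∈ (Subgroup.closure S).toSubmonoid := by simp [hgen]
  rw [Subgroup.closure_toSubmonoid] at hg
  obtain ⟨l, hl, rfl⟩ := Submonoid.exists_list_of_mem_closure hg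
  refine ⟨l, fun x hx => ?_, rfl⟩
  rcases hl x hx with h | h
  · exact h
  · simpa using hsym _ h

open scoped Pointwise in
theorem Finset.list_prod_mem_pow {T : Finset G} (l : List G) (hl : ∀ x ∈ l, x ∈ T) :
    l.prod ∈ T ^ l.length := by
  induction l with
  | nil => simp
  | cons a l ih =>
    rw [List.prod_cons, List.length_cons, pow_succ']
    exact Finset.mul_mem_mul (hl a (by simp)) (ih fun x hx => hl x (by simp [hx]))

open scoped Pointwise in
theorem ball_subset_insert_one_pow {S : Finset G} (hsym : ∀ s ∈ S, s⁻¹ ∈ S)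
    (hgen : Subgroup.closure (S : Set G) = ⊤) (n : ℕ) :
    ball (S : Set G) n ⊆ ((insert 1 S) ^ n : Finset G) := by
  intro g hg
  have hne : {n | ∃ l : List G, (∀ x ∈ l, x ∈ (S : Set G)) ∧ l.length = n ∧
      l.prod = g}.Nonempty := by
    obtain ⟨l, hl, hp⟩ := exists_list_prod_eq (S := (S : Set G)) hsym hgen g
    exact ⟨l.length, l, hl, rfl, hp⟩
  obtain ⟨l, hl, hlen, rfl⟩ := Nat.sInf_mem hne
  have hln : l.length ≤ n := hlen.trans_le hg
  exact Finset.pow_subset_pow_right (Finset.mem_insert_self 1 S) hln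
    (Finset.list_prod_mem_pow l fun x hx => Finset.mem_insert_of_mem (hl x hx))

theorem finite_ball {S : Finset G} (hsym : ∀ s ∈ S, s⁻¹ ∈ S)
    (hgen : Subgroup.closure (S : Set G) = ⊤) (n : ℕ) : (ball (S : Set G) n).Finite :=
  (Finset.finite_toSet _).subset (ball_subset_insert_one_pow hsym hgen n)

theorem card_ball_le {S : Finset G} (hsym : ∀ s ∈ S, s⁻¹ ∈ S)
    (hgen : Subgroup.closure (S : Set G) = ⊤) (n : ℕ) :
    Nat.card (ball (S : Set G) n) ≤ (S.card + 1) ^ n := by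
  calc Nat.card (ball (S : Set G) n)
      ≤ _ := Nat.card_mono (Finset.finite_toSet _) (ball_subset_insert_one_pow hsym hgen n)
    _ ≤ (insert 1 S : Finset G).card ^ n := by
      rw [Nat.card_coe_set_eq, Set.ncard_coe_finset]
      exact Finset.card_pow_le
    _ ≤ (S.card + 1) ^ n := Nat.pow_le_pow_left (Finset.card_insert_le _ _) n

theorem card_ball_pos {S : Finset G} (hsym : ∀ s ∈ S, s⁻¹ ∈ S)
    (hgen : Subgroup.closure (S : Set G) = ⊤) (n : ℕ) : 0 < Nat.card (ball (S : Set G) n) := by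
  have := (finite_ball hsym hgen n).to_subtype
  have : Nonempty (ball (S : Set G) n) := ⟨1, by simp [ball, wordLength_one]⟩
  exact Nat.card_pos

theorem one_lt_card_ball {S : Finset G} (hS1 : (1 : G) ∉ S) (hSne : S.Nonempty)
    (hsym : ∀ s ∈ S, s⁻¹ ∈ S) (hgen : Subgroup.closure (S : Set G) = ⊤) {n : ℕ} (hn : 1 ≤ n) :
    1 < Nat.card (ball (S : Set G) n) := by
  obtain ⟨s, hs⟩ := hSne
  rw [Nat.card_coe_set_eq, Set.one_lt_ncard (finite_ball hsym hgen n)]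
  refine ⟨1, by simp [ball, wordLength_one], s, ?_, fun h => hS1 (h ▸ hs)⟩
  exact (wordLength_le_one_of_mem (Finset.mem_coe.2 hs)).trans hn

theorem growthLog_nonneg (S : Set G) (n : ℕ) : 0 ≤ growthLog S n :=
  Real.log_natCast_nonneg _

theorem growthLog_le {S : Finset G} (hsym : ∀ s ∈ S, s⁻¹ ∈ S)
    (hgen : Subgroup.closure (S : Set G) = ⊤) (n : ℕ) :
    growthLog (S : Set G) n ≤ Real.log (S.card + 1) * n := by
  rw [mul_comm, ← Real.log_pow]
  refine Real.log_le_log (Nat.cast_pos.2 (card_ball_pos hsym hgen n)) ?_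
  exact_mod_cast card_ball_le hsym hgen n

theorem growthLog_pos {S : Finset G} (hS1 : (1 : G) ∉ S) (hSne : S.Nonempty)
    (hsym : ∀ s ∈ S, s⁻¹ ∈ S) (hgen : Subgroup.closure (S : Set G) = ⊤) {n : ℕ} (hn : 1 ≤ n) :
    0 < growthLog (S : Set G) n :=
  Real.log_pos (by exact_mod_cast one_lt_card_ball hS1 hSne hsym hgen hn)

theorem concaveHull_growthLog_pos {S : Finset G} (hS1 : (1 : G) ∉ S) (hSne : S.Nonempty)
    (hsym : ∀ s ∈ S, s⁻¹ ∈ S) (hgen : Subgroup.closure (S : Set G) = ⊤) {x : ℝ} (hx : 1 ≤ x) :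
    0 < concaveHull (growthLog (S : Set G)) x := by
  have hpos : ∀ k : ℕ, 1 ≤ k → 0 < concaveHull (growthLog (S : Set G)) k := fun k hk =>
    (growthLog_pos hS1 hSne hsym hgen hk).trans_le
      (le_concaveHull_natCast (growthLog_le hsym hgen) k)
  have hx0 : 0 ≤ x := zero_le_one.trans hx
  have h1 : 1 ≤ ⌊x⌋₊ := (Nat.one_le_floor_iff x).2 hx
  have h := (concaveOn_concaveHull (growthLog_nonneg _) (growthLog_le hsym hgen)).min_le_of_mem_Icc
    (x := (⌊x⌋₊ : ℝ)) (y := (⌈x⌉₊ : ℝ))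
    (Set.mem_Ici.2 (Nat.cast_nonneg _)) (Set.mem_Ici.2 (Nat.cast_nonneg _))
    ⟨Nat.floor_le hx0, Nat.le_ceil x⟩
  exact (lt_min (hpos _ h1) (hpos _ (h1.trans (Nat.floor_le_ceil x)))).trans_le h

end WordLength

section Convolution

variable {G : Type*} [Group G]

theorem lazyWalk_nonneg (S : Finset G) (g : G) : 0 ≤ lazyWalk S g := by
  unfold lazyWalk
  positivity

theorem hasSum_lazyWalk {S : Finset G} (hSne : S.Nonempty) : HasSum (lazyWalk S) 1 := by
  have h1 : HasSum (fun g : G => if g = 1 then (1 : ℝ) / 2 else 0) (1 / 2) := hasSum_ite_eq 1 _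
  have h2 : HasSum (fun g : G => if g ∈ S then 1 / (2 * (S.card : ℝ)) else 0) (1 / 2) := by
    have h := hasSum_sum_of_ne_finset_zero (s := S) (L := .unconditional G)
      (f := fun g : G => if g ∈ S then 1 / (2 * (S.card : ℝ)) else 0) (fun g hg => if_neg hg)
    convert h using 1
    rw [Finset.sum_congr rfl fun g hg => if_pos hg, Finset.sum_const, nsmul_eq_mul]
    have : (S.card : ℝ) ≠ 0 := by exact_mod_cast hSne.card_pos.ne'
    field_simp
  have h := h1.add h2
  rw [add_halves] at h
  exact h

theorem convPow_nonneg {P : G → ℝ} (hP : ∀ g, 0 ≤ P g) (n : ℕ) (g : G) : 0 ≤ convPow P n g := by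
  induction n generalizing g with
  | zero => unfold convPow; positivity
  | succ n ih => exact tsum_nonneg fun h => mul_nonneg (ih h) (hP _)

theorem hasSum_convPow {P : G → ℝ} (hP : ∀ g, 0 ≤ P g) (hP1 : HasSum P 1) (n : ℕ) :
    HasSum (convPow P n) 1 := by
  induction n with
  | zero => exact hasSum_ite_eq 1 _
  | succ n ih =>
    have hprod : HasSum (fun x : G × G => convPow P n x.1 * P x.2) (1 * 1) :=
      ih.mul hP1 (ih.summable.mul_of_nonneg hP1.summable (convPow_nonneg hP n) hP)
    let e : G × G ≃ G × G :=
      { toFun := fun x => (x.2, x.2⁻¹ * x.1)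
        invFun := fun x => (x.1 * x.2, x.1)
        left_inv := fun x => by simp
        right_inv := fun x => by simp }
    have h := e.hasSum_iff.2 hprod
    rw [one_mul] at h
    exact h.prod_fiberwise fun g => (h.summable.prod_factor g).hasSum

end Convolution

section TailBound

variable {G : Type*} [Group G]

theorem sum_le_of_inv_sq_card_ball {S : Finset G} (hsym : ∀ s ∈ S, s⁻¹ ∈ S)
    (hgen : Subgroup.closure (S : Set G) = ⊤) {c : ℝ} (hc : 0 < c)
    (hvol : ∀ n : ℕ, 1 ≤ n → c * (n : ℝ) ^ 3 ≤ (Nat.card (ball (S : Set G) n) : ℝ))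
    {q : G → ℝ} {N : ℝ} (hN : 0 ≤ N) {R : ℕ}
    (hq : ∀ g, R < wordLength (S : Set G) g →
      q g ≤ N * ((Nat.card (ball (S : Set G) (wordLength (S : Set G) g)) : ℝ) ^ 2)⁻¹)
    (T : Finset G) (hT : ∀ g ∈ T, R < wordLength (S : Set G) g) :
    ∑ g ∈ T, q g ≤ N / c * (2 / (R + 1)) := by
  set m := T.sup (wordLength (S : Set G)) + 1
  have hmaps : ∀ g ∈ T, wordLength (S : Set G) g ∈ Finset.Ioo R m := fun g hg =>
    Finset.mem_Ioo.2 ⟨hT g hg, Nat.lt_succ_of_le (Finset.le_sup hg)⟩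
  rw [← Finset.sum_fiberwise_of_maps_to hmaps]
  calc _ ≤ ∑ k ∈ Finset.Ioo R m, N / c * ((k : ℝ) ^ 2)⁻¹ := ?_
    _ = N / c * ∑ k ∈ Finset.Ioo R m, ((k : ℝ) ^ 2)⁻¹ := by rw [Finset.mul_sum]
    _ ≤ _ := by
      gcongr
      exact sum_Ioo_inv_sq_le R m
  refine Finset.sum_le_sum fun k hk => ?_
  have hRk := (Finset.mem_Ioo.1 hk).1
  have hk1 : 1 ≤ k := by omega
  have hk1' : (1 : ℝ) ≤ k := by exact_mod_cast hk1
  set b : ℝ := (Nat.card (ball (S : Set G) k) : ℝ) with hb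
  have hbpos : 0 < b := Nat.cast_pos.2 (card_ball_pos hsym hgen k)
  have hcard : ((T.filter fun g => wordLength (S : Set G) g = k).card : ℝ) ≤ b := by
    have h := Nat.card_mono (finite_ball hsym hgen k)
      (s := ((T.filter fun g => wordLength (S : Set G) g = k : Finset G) : Set G)) (by
        intro g hg
        exact (Finset.mem_filter.1 (Finset.mem_coe.1 hg)).2.le)
    rw [Nat.card_coe_set_eq, Set.ncard_coe_finset] at h
    exact Nat.cast_le.2 h
  have hck : c * (k : ℝ) ^ 2 ≤ b := by
    refine le_trans ?_ (hvol k hk1)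
    exact mul_le_mul_of_nonneg_left (pow_le_pow_right₀ hk1' (by norm_num)) hc.le
  calc ∑ g ∈ T with wordLength (S : Set G) g = k, q g
      ≤ (T.filter fun g => wordLength (S : Set G) g = k).card • (N * (b ^ 2)⁻¹) := by
        refine Finset.sum_le_card_nsmul _ _ _ fun g hg => ?_
        have hgk := (Finset.mem_filter.1 hg).2
        have h := hq g (hgk ▸ hRk)
        rwa [hgk] at h
    _ ≤ b * (N * (b ^ 2)⁻¹) := by
        rw [nsmul_eq_mul]
        gcongr
    _ = N * b⁻¹ := by field_simp
    _ ≤ N * (c * (k : ℝ) ^ 2)⁻¹ := by gcongr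
    _ = N / c * ((k : ℝ) ^ 2)⁻¹ := by rw [mul_inv, div_eq_mul_inv, mul_assoc]

theorem one_le_card_ball_mul_add {S : Finset G} (hsym : ∀ s ∈ S, s⁻¹ ∈ S)
    (hgen : Subgroup.closure (S : Set G) = ⊤) {q : G → ℝ} (hq1 : HasSum q 1) {p t : ℝ}
    (hp : 0 ≤ p) (hqp : ∀ g, q g ≤ p) (R : ℕ)
    (ht : ∀ T : Finset G, (∀ g ∈ T, R < wordLength (S : Set G) g) → ∑ g ∈ T, q g ≤ t) :
    1 ≤ Nat.card (ball (S : Set G) R) * p + t := by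
  refine hasSum_le_of_sum_le hq1 fun T => ?_
  rw [← Finset.sum_filter_add_sum_filter_not T fun g => wordLength (S : Set G) g ≤ R]
  refine add_le_add ?_ (ht _ fun g hg => not_le.1 (Finset.mem_filter.1 hg).2)
  refine (Finset.sum_le_card_nsmul _ _ p fun g _ => hqp g).trans ?_
  rw [nsmul_eq_mul]
  have h := Nat.card_mono (finite_ball hsym hgen R)
    (s := ((T.filter fun g => wordLength (S : Set G) g ≤ R : Finset G) : Set G)) (by
      intro g hg
      exact (Finset.mem_filter.1 (Finset.mem_coe.1 hg)).2)
  rw [Nat.card_coe_set_eq, Set.ncard_coe_finset] at h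
  gcongr

end TailBound

/-- under at least cubic growth and the interpolated off-diagonal
estimate, `P^{(n)}(e) ≥ K'' |B_{⌈F(L''n)⌉}|⁻² F(L''n)⁻¹` for large `n`, where `f` is the
concave hull of `f_V = ln|B_·|` and `F` inverts the strictly increasing map `x ↦ x²/f(x)`
on `[1,∞)`. -/
theorem stmt16 {G : Type*} [Group G] (S : Finset G)
    (hS1 : (1 : G) ∉ S) (hSne : S.Nonempty) (hsym : ∀ s ∈ S, s⁻¹ ∈ S)
    (hgen : Subgroup.closure (S : Set G) = ⊤)
    (c : ℝ) (hc : 0 < c)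
    (hvol : ∀ n : ℕ, 1 ≤ n → c * (n : ℝ) ^ 3 ≤ (Nat.card ↥(ball (S : Set G) n) : ℝ))
    (M N : ℝ) (hM : 0 < M) (hN : 0 < N)
    (hOD : ∀ ε : ℝ, 0 ≤ ε → ε ≤ 1 → ∀ (g : G) (n : ℕ), 1 ≤ n →
      convPow (lazyWalk S) n g ≤
        (convPow (lazyWalk S) n 1) ^ (1 - ε) * N ^ ε *
          Real.exp (-ε * M * (wordLength (S : Set G) g : ℝ) ^ 2 / (n : ℝ))) :
    StrictMonoOn (fun x : ℝ => x ^ 2 / concaveHull (growthLog (S : Set G)) x)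
        (Set.Ici 1) ∧
      ∃ F : ℝ → ℝ,
        (∀ x : ℝ, 1 ≤ x →
          F (x ^ 2 / concaveHull (growthLog (S : Set G)) x) = x) ∧
        ∃ K'' L'' : ℝ, 0 < K'' ∧ 0 < L'' ∧ ∃ n₀ : ℕ, ∀ n : ℕ, n₀ ≤ n →
          1 ≤ F (L'' * (n : ℝ)) ∧
          (F (L'' * (n : ℝ))) ^ 2 / concaveHull (growthLog (S : Set G)) (F (L'' * (n : ℝ)))
            = L'' * (n : ℝ) ∧
          K'' * ((Nat.card ↥(ball (S : Set G) ⌈F (L'' * (n : ℝ))⌉₊) : ℝ) ^ 2 *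
              F (L'' * (n : ℝ)))⁻¹ ≤
            convPow (lazyWalk S) n 1 := by
  set f := concaveHull (growthLog (S : Set G)) with hf
  have hconc : ConcaveOn ℝ (Set.Ici 0) f :=
    concaveOn_concaveHull (growthLog_nonneg _) (growthLog_le hsym hgen)
  have hf0 : 0 ≤ f 0 := by
    simpa using (growthLog_nonneg (S : Set G) 0).trans
      (le_concaveHull_natCast (growthLog_le hsym hgen) 0)
  have hfpos : ∀ x, 1 ≤ x → 0 < f x := fun x hx =>
    concaveHull_growthLog_pos hS1 hSne hsym hgen hx
  have hmono := hconc.strictMonoOn_sq_div hf0 hfpos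
  refine ⟨hmono, Function.invFunOn (fun x => x ^ 2 / f x) (Set.Ici 1),
    fun x hx => hmono.injOn.leftInvOn_invFunOn hx, 1 / 2, 2 / M, by norm_num, by positivity, ?_⟩
  set A : ℝ := max 1 (4 * N / c) with hA
  have hA1 : 1 ≤ A := le_max_left _ _
  refine ⟨⌈A ^ 2 / f A / (2 / M)⌉₊, fun n hn => ?_⟩
  have hAn : A ^ 2 / f A ≤ 2 / M * n := by
    have h := (Nat.le_ceil _).trans (Nat.cast_le (α := ℝ).2 hn)
    rwa [div_le_iff₀' (by positivity)] at h
  have hAf : 0 < A ^ 2 / f A := div_pos (by positivity) (hfpos A hA1)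
  have hn0 : (0 : ℝ) < n := pos_of_mul_pos_right (hAf.trans_le hAn) (by positivity)
  have hn1 : 1 ≤ n := by exact_mod_cast hn0
  have hex : ∃ x ∈ Set.Ici (1 : ℝ), x ^ 2 / f x = 2 / M * n := by
    refine hconc.exists_sq_div_eq hf0 hfpos (le_trans ?_ hAn)
    simpa using hmono.monotoneOn (Set.mem_Ici.2 le_rfl) (Set.mem_Ici.2 hA1) hA1
  have hr1 : 1 ≤ Function.invFunOn (fun x => x ^ 2 / f x) (Set.Ici 1) (2 / M * n) :=
    Function.invFunOn_mem hex
  have hr : Function.invFunOn (fun x => x ^ 2 / f x) (Set.Ici 1) (2 / M * n) ^ 2 /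
      f (Function.invFunOn (fun x => x ^ 2 / f x) (Set.Ici 1) (2 / M * n)) = 2 / M * n :=
    Function.invFunOn_eq (f := fun x => x ^ 2 / f x) hex
  generalize Function.invFunOn (fun x => x ^ 2 / f x) (Set.Ici 1) (2 / M * n) = r at hr1 hr ⊢
  refine ⟨hr1, hr, ?_⟩
  have hr0 : 0 < r := zero_lt_one.trans_le hr1
  have hfr := hfpos r hr1
  have hAr : A ≤ r := (hmono.le_iff_le (Set.mem_Ici.2 hA1) (Set.mem_Ici.2 hr1)).1
    (by simpa only [hr] using hAn)
  have hrn : r ^ 2 * M = 2 * n * f r := by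
    rw [div_eq_iff hfr.ne'] at hr
    rw [hr]
    field_simp
  have hexp : ∀ k : ℕ, ⌈r⌉₊ < k →
      Real.exp (-1 * M * (k : ℝ) ^ 2 / n) ≤ ((Nat.card (ball (S : Set G) k) : ℝ) ^ 2)⁻¹ := by
    intro k hk
    have hrk : r ≤ k := (Nat.le_ceil r).trans (Nat.cast_le.2 hk.le)
    have hb : (0 : ℝ) < Nat.card (ball (S : Set G) k) :=
      Nat.cast_pos.2 (card_ball_pos hsym hgen k)
    have hmul := hconc.mul_le_mul_of_le hf0 hr0 hrk
    have hkf := le_concaveHull_natCast (growthLog_le hsym hgen) k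
    rw [← hf] at hkf
    have hu := growthLog_nonneg (S : Set G) k
    have hkey : 2 * growthLog (S : Set G) k ≤ M * (k : ℝ) ^ 2 / n := by
      rw [le_div_iff₀ hn0]
      refine le_of_mul_le_mul_left (a := r ^ 2) ?_ (by positivity)
      calc r ^ 2 * (2 * growthLog (S : Set G) k * n)
          ≤ r ^ 2 * (2 * f k * n) := by gcongr
        _ = 2 * n * r * (r * f k) := by ring
        _ ≤ 2 * n * k * (k * f r) := by
          have : 0 ≤ r * f k := mul_nonneg hr0.le (hu.trans hkf)
          gcongr
        _ = (2 * n * f r) * (k : ℝ) ^ 2 := by ring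
        _ = r ^ 2 * (M * (k : ℝ) ^ 2) := by rw [← hrn]; ring
    calc Real.exp (-1 * M * (k : ℝ) ^ 2 / n)
        ≤ Real.exp (-(2 * growthLog (S : Set G) k)) := by
          refine Real.exp_le_exp.2 ?_
          rw [neg_one_mul, neg_mul, neg_div]
          exact neg_le_neg hkey
      _ = _ := by
          rw [Real.exp_neg, two_mul, Real.exp_add, growthLog, Real.exp_log hb, sq]
  have htail := sum_le_of_inv_sq_card_ball (q := convPow (lazyWalk S) n) hsym hgen hc hvol hN.le
    (R := ⌈r⌉₊) fun g hg => by
      refine (hOD 1 zero_le_one le_rfl g n hn1).trans ?_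
      rw [sub_self, Real.rpow_zero, one_mul, Real.rpow_one]
      exact mul_le_mul_of_nonneg_left (hexp _ hg) hN.le
  have hp := convPow_nonneg (lazyWalk_nonneg S) n 1
  have hone := one_le_card_ball_mul_add hsym hgen
    (hasSum_convPow (lazyWalk_nonneg S) (hasSum_lazyWalk hSne) n) hp
    (fun g => by simpa using hOD 0 le_rfl zero_le_one g n hn1) ⌈r⌉₊ htail
  have hsmall : N / c * (2 / ((⌈r⌉₊ : ℝ) + 1)) ≤ 1 / 2 := by
    have h : 4 * N / c ≤ (⌈r⌉₊ : ℝ) :=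
      (le_max_right _ _).trans (hAr.trans (Nat.le_ceil r))
    rw [← mul_div_assoc, div_le_iff₀ (by positivity)]
    have : 4 * N / c = 4 * (N / c) := by ring
    linarith
  have hb1 : (1 : ℝ) ≤ Nat.card (ball (S : Set G) ⌈r⌉₊) := by
    exact_mod_cast card_ball_pos hsym hgen ⌈r⌉₊
  generalize (Nat.card (ball (S : Set G) ⌈r⌉₊) : ℝ) = b at hone hb1 ⊢
  have hbr : 1 ≤ b * r := one_le_mul_of_one_le_of_one_le hb1 hr1
  rw [← div_eq_mul_inv, div_le_iff₀ (by positivity)]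
  calc 1 / 2 ≤ b * convPow (lazyWalk S) n 1 := by linarith
    _ ≤ (b * convPow (lazyWalk S) n 1) * (b * r) := le_mul_of_one_le_right (by positivity) hbr
    _ = convPow (lazyWalk S) n 1 * (b ^ 2 * r) := by ring
end

section
/- Let G be a group with a finite symmetric generating set S (e ∉ S), let P be the lazy simple random walk measure, and suppose there exists a nontrivial group homomorphism from G to ℤ. Then there is a constant K > 0 such that E|P^{(n)}| = Σ_{g∈G} P^{(n)}(g)·|g| ≥ K·n^{1/2} for all n ≥ 1. -/
open scoped Classical

/-- The Markov operator of the lazy simple random walk. -/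
noncomputable def lazyOp {G : Type*} [Group G] (S : Finset G) (F : G → ℝ) : G → ℝ :=
  fun g => 1 / 2 * F g + 1 / (2 * (S.card : ℝ)) * ∑ s ∈ S, F (g * s)

theorem convPow_lazyWalk_succ {G : Type*} [Group G] (S : Finset G) (n : ℕ) (g : G) :
    convPow (lazyWalk S) (n + 1) g = 1 / 2 * convPow (lazyWalk S) n g
      + 1 / (2 * (S.card : ℝ)) * ∑ s ∈ S, convPow (lazyWalk S) n (g * s⁻¹) := by
  set p := convPow (lazyWalk S) n
  set c : ℝ := 1 / (2 * (S.card : ℝ))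
  have hP : ∀ h : G, p h * lazyWalk S (h⁻¹ * g) =
      (if h = g then 1 / 2 * p g else 0)
        + ∑ s ∈ S, if h = g * s⁻¹ then c * p (g * s⁻¹) else 0 := by
    intro h
    have h1 : h⁻¹ * g = 1 ↔ h = g := by rw [inv_mul_eq_one]
    have h2 : (∑ s ∈ S, if h = g * s⁻¹ then c * p (g * s⁻¹) else 0) =
        if h⁻¹ * g ∈ S then c * p h else 0 := by
      rw [← Finset.sum_ite_eq S (h⁻¹ * g) fun _ => c * p h]
      refine Finset.sum_congr rfl fun s _ => ?_
      have h3 : h = g * s⁻¹ ↔ h⁻¹ * g = s := by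
        rw [eq_mul_inv_iff_mul_eq, inv_mul_eq_iff_eq_mul, eq_comm]
      by_cases h4 : h = g * s⁻¹
      · rw [if_pos h4, if_pos (h3.1 h4), ← h4]
      · rw [if_neg h4, if_neg fun h5 => h4 (h3.2 h5)]
    rw [h2]
    simp only [lazyWalk, h1]
    split_ifs with h4 <;> simp_all [c] <;> ring
  have hsum : HasSum (fun h => p h * lazyWalk S (h⁻¹ * g))
      (1 / 2 * p g + ∑ s ∈ S, c * p (g * s⁻¹)) := by
    simp only [hP]
    exact (hasSum_ite_eq g _).add (hasSum_sum fun s _ => hasSum_ite_eq (g * s⁻¹) _)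
  rw [Finset.mul_sum]
  exact hsum.tsum_eq

theorem convPow_lazyWalk_nonneg {G : Type*} [Group G] (S : Finset G) (n : ℕ) (g : G) :
    0 ≤ convPow (lazyWalk S) n g := by
  induction n generalizing g with
  | zero => simp only [convPow]; split_ifs <;> norm_num
  | succ n ih =>
    rw [convPow_lazyWalk_succ]
    have := Finset.sum_nonneg fun s (_ : s ∈ S) => ih (g * s⁻¹)
    have := ih g
    positivity

/-- The expectation of `F` at time `n` is obtained by iterating the Markov operator. -/
theorem hasSum_convPow_lazyWalk {G : Type*} [Group G] (S : Finset G) (n : ℕ) (F : G → ℝ) :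
    HasSum (fun g => convPow (lazyWalk S) n g * F g) ((lazyOp S)^[n] F 1) := by
  induction n generalizing F with
  | zero =>
    have h : (fun g => convPow (lazyWalk S) 0 g * F g) = fun g => if g = 1 then F 1 else 0 := by
      funext g
      simp only [convPow]
      split_ifs with h <;> simp [h]
    rw [h]
    exact hasSum_ite_eq 1 (F 1)
  | succ n ih =>
    rw [Function.iterate_succ_apply]
    have h1 : HasSum (fun g => ∑ s ∈ S, convPow (lazyWalk S) n (g * s⁻¹) * F g)
        (∑ s ∈ S, (lazyOp S)^[n] (fun g => F (g * s)) 1) := by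
      refine hasSum_sum fun s _ => ?_
      have := (Equiv.mulRight s⁻¹).hasSum_iff.2 (ih fun g => F (g * s))
      simpa [Function.comp_def] using this
    have h2 := ((ih F).mul_left (1 / 2)).add (h1.mul_left (1 / (2 * (S.card : ℝ))))
    have h3 := ((ih F).mul_left (1 / 2)).add
      ((hasSum_sum fun s (_ : s ∈ S) => ih fun g => F (g * s)).mul_left (1 / (2 * (S.card : ℝ))))
    have h4 : (lazyOp S)^[n] (lazyOp S F) 1 = 1 / 2 * (lazyOp S)^[n] F 1
        + 1 / (2 * (S.card : ℝ)) * ∑ s ∈ S, (lazyOp S)^[n] (fun g => F (g * s)) 1 := by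
      refine (ih (lazyOp S F)).unique ?_
      refine h3.congr_fun fun g => ?_
      rw [lazyOp, ← Finset.mul_sum]
      ring
    rw [h4]
    refine h2.congr_fun fun g => ?_
    rw [convPow_lazyWalk_succ, ← Finset.sum_mul]
    ring

theorem sum_odd_eq_zero {G : Type*} [Group G] {S : Finset G} (hsym : ∀ s ∈ S, s⁻¹ ∈ S)
    {u : G → ℝ} (hu : ∀ g, u g⁻¹ = -u g) : ∑ s ∈ S, u s = 0 := by
  have h : ∑ s ∈ S, u s = ∑ s ∈ S, u s⁻¹ :=
    Finset.sum_nbij' (·⁻¹) (·⁻¹) hsym hsym (by simp) (by simp) (by simp)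
  simp only [hu, Finset.sum_neg_distrib] at h
  linarith

/-- The Markov operator on even quartic polynomials in an additive function. -/
theorem lazyOp_quartic {G : Type*} [Group G] {S : Finset G} (hSne : S.Nonempty)
    (hsym : ∀ s ∈ S, s⁻¹ ∈ S) {f : G → ℝ} (hf : ∀ x y, f (x * y) = f x + f y)
    {v m : ℝ} (hv : v = 1 / (2 * (S.card : ℝ)) * ∑ s ∈ S, f s ^ 2)
    (hm : m = 1 / (2 * (S.card : ℝ)) * ∑ s ∈ S, f s ^ 4) (a b c : ℝ) :
    lazyOp S (fun g => a * f g ^ 4 + b * f g ^ 2 + c) =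
      fun g => a * f g ^ 4 + (b + 6 * a * v) * f g ^ 2 + (c + b * v + a * m) := by
  have hf1 : f 1 = 0 := by simpa using hf 1 1
  have hinv : ∀ g, f g⁻¹ = -f g := fun g => by
    have := hf g g⁻¹
    rw [mul_inv_cancel, hf1] at this
    linarith
  have o1 : ∑ s ∈ S, f s = 0 := sum_odd_eq_zero hsym hinv
  have o3 : ∑ s ∈ S, f s ^ 3 = 0 :=
    sum_odd_eq_zero hsym (u := fun g => f g ^ 3) fun g => by rw [hinv]; ring
  have hcard : (S.card : ℝ) ≠ 0 := by exact_mod_cast hSne.card_ne_zero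
  funext g
  have hexp : ∑ s ∈ S, (a * f (g * s) ^ 4 + b * f (g * s) ^ 2 + c) =
      S.card * (a * f g ^ 4 + b * f g ^ 2 + c) + (4 * a * f g ^ 3 + 2 * b * f g) * ∑ s ∈ S, f s
        + (6 * a * f g ^ 2 + b) * ∑ s ∈ S, f s ^ 2 + 4 * a * f g * ∑ s ∈ S, f s ^ 3
        + a * ∑ s ∈ S, f s ^ 4 := by
    rw [← nsmul_eq_mul, ← Finset.sum_const]
    simp only [Finset.mul_sum, ← Finset.sum_add_distrib, hf]
    exact Finset.sum_congr rfl fun s _ => by ring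
  rw [lazyOp, hexp, o1, o3, hv, hm]
  field_simp
  ring

theorem iterate_lazyOp_quartic {G : Type*} [Group G] {S : Finset G} (hSne : S.Nonempty)
    (hsym : ∀ s ∈ S, s⁻¹ ∈ S) {f : G → ℝ} (hf : ∀ x y, f (x * y) = f x + f y)
    {v m : ℝ} (hv : v = 1 / (2 * (S.card : ℝ)) * ∑ s ∈ S, f s ^ 2)
    (hm : m = 1 / (2 * (S.card : ℝ)) * ∑ s ∈ S, f s ^ 4) (n : ℕ) (a b c : ℝ) :
    (lazyOp S)^[n] (fun g => a * f g ^ 4 + b * f g ^ 2 + c) 1 =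
      c + n * (b * v + a * m) + 3 * a * v ^ 2 * (n * (n - 1)) := by
  induction n generalizing a b c with
  | zero =>
    have hf1 : f 1 = 0 := by simpa using hf 1 1
    simp [hf1]
  | succ n ih =>
    rw [Function.iterate_succ_apply, lazyOp_quartic hSne hsym hf hv hm, ih]
    push_cast
    ring

theorem exists_list_length_eq_wordLength {G : Type*} [Group G] {S : Set G}
    (hsym : ∀ s ∈ S, s⁻¹ ∈ S) (hgen : Subgroup.closure S = ⊤) (g : G) :
    ∃ l : List G, (∀ x ∈ l, x ∈ S) ∧ l.length = wordLength S g ∧ l.prod = g := by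
  refine Nat.sInf_mem (s := {n | ∃ l : List G, (∀ x ∈ l, x ∈ S) ∧ l.length = n ∧ l.prod = g}) ?_
  have hg : g ∈ Submonoid.closure (S ∪ S⁻¹) := by
    rw [← Subgroup.closure_toSubmonoid, hgen]
    trivial
  obtain ⟨l, hl, hprod⟩ := Submonoid.exists_list_of_mem_closure hg
  exact ⟨l.length, l, fun x hx => (hl x hx).elim id fun h => by simpa using hsym _ h,
    rfl, hprod⟩

/-- An additive function is Lipschitz for the word length. -/
theorem abs_le_mul_wordLength {G : Type*} [Group G] {S : Set G}
    (hsym : ∀ s ∈ S, s⁻¹ ∈ S) (hgen : Subgroup.closure S = ⊤)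
    {f : G → ℝ} (hf : ∀ x y, f (x * y) = f x + f y) {M : ℝ} (hM : ∀ s ∈ S, |f s| ≤ M) (g : G) :
    |f g| ≤ M * wordLength S g := by
  obtain ⟨l, hl, hlen, rfl⟩ := exists_list_length_eq_wordLength hsym hgen g
  rw [← hlen]
  clear hlen
  induction l with
  | nil => simpa using hf 1 1
  | cons x l ih =>
    rw [List.prod_cons, hf, List.length_cons]
    have h1 := hM x (hl x (by simp))
    have h2 := ih fun y hy => hl y (by simp [hy])
    have h3 := abs_add_le (f x) (f l.prod)
    push_cast
    linarith

theorem sq_div_sub_pow_four_div_le_abs (y : ℝ) {t : ℝ} (ht : 0 < t) :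
    -(1 / t ^ 3) * y ^ 4 + 1 / t * y ^ 2 + 0 ≤ |y| := by
  have key : ∀ u : ℝ, 0 ≤ u → u ^ 2 - u ^ 4 ≤ u := fun u hu => by
    nlinarith [mul_nonneg hu (sq_nonneg (u - 1)), mul_nonneg hu (sq_nonneg u),
      mul_nonneg hu (mul_nonneg hu (sq_nonneg (u - 1)))]
  have h := mul_le_mul_of_nonneg_left (key (|y| / t) (by positivity)) ht.le
  have h4 : |y| ^ 4 = y ^ 4 := Even.pow_abs (by decide) y
  rw [div_pow, div_pow, sq_abs, h4, mul_div_cancel₀ _ ht.ne'] at h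
  refine le_of_eq_of_le ?_ h
  field_simp
  ring

/-- if `G` admits a nontrivial homomorphism to `ℤ`, then the speed of
the lazy walk is at least `K √n`. -/
theorem stmt19 {G : Type*} [Group G] (S : Finset G)
    (hS1 : (1 : G) ∉ S) (hSne : S.Nonempty) (hsym : ∀ s ∈ S, s⁻¹ ∈ S)
    (hgen : Subgroup.closure (S : Set G) = ⊤)
    (hhom : ∃ φ : G →* Multiplicative ℤ, φ ≠ 1) :
    ∃ K : ℝ, 0 < K ∧ ∀ n : ℕ, 1 ≤ n →
      K * (n : ℝ) ^ ((1 : ℝ) / 2) ≤ speed (S : Set G) (lazyWalk S) n := by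
  obtain ⟨φ, hφ⟩ := hhom
  set f : G → ℝ := fun g => ((φ g).toAdd : ℝ) with hfdef
  have hf : ∀ x y, f (x * y) = f x + f y := fun x y => by simp [hfdef]
  obtain ⟨s, hs, hfs⟩ : ∃ s ∈ S, f s ≠ 0 := by
    by_contra! h
    exact hφ (MonoidHom.eq_of_eqOn_dense hgen fun s hs => by simpa [hfdef] using h s hs)
  have hcard : 0 < (S.card : ℝ) := by exact_mod_cast hSne.card_pos
  obtain ⟨v, hv⟩ : ∃ v, v = 1 / (2 * (S.card : ℝ)) * ∑ s ∈ S, f s ^ 2 := ⟨_, rfl⟩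
  obtain ⟨m, hm⟩ : ∃ m, m = 1 / (2 * (S.card : ℝ)) * ∑ s ∈ S, f s ^ 4 := ⟨_, rfl⟩
  have hvpos : 0 < v := by
    have : 0 < ∑ s ∈ S, f s ^ 2 :=
      Finset.sum_pos' (fun _ _ => sq_nonneg _) ⟨s, hs, by positivity⟩
    rw [hv]
    positivity
  have hmnn : 0 ≤ m := by
    rw [hm]
    exact mul_nonneg (by positivity) (Finset.sum_nonneg fun _ _ => by positivity)
  obtain ⟨M, hMdef⟩ : ∃ M, M = ∑ s ∈ S, |f s| := ⟨_, rfl⟩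
  have hM : ∀ s ∈ S, |f s| ≤ M := fun s hs =>
    hMdef ▸ Finset.single_le_sum (f := fun s => |f s|) (fun _ _ => abs_nonneg _) hs
  have hMpos : 0 < M := (abs_pos.2 hfs).trans_le (hM s hs)
  set C : ℝ := m + 3 * v ^ 2 with hC
  set A : ℝ := 1 + C / v with hA
  have hCpos : 0 < C := by positivity
  have hApos : 0 < A := by positivity
  have hCA : C < v * A ^ 2 := by
    have h1 : v * A = v + C := by rw [hA]; field_simp
    have h2 : 1 < A := lt_add_of_pos_right 1 (by positivity)
    nlinarith
  refine ⟨(v * A ^ 2 - C) / A ^ 3 / M, by have := sub_pos.2 hCA; positivity, fun n hn => ?_⟩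
  rw [← Real.sqrt_eq_rpow]
  have hn1 : (1 : ℝ) ≤ n := by exact_mod_cast hn
  set r : ℝ := √n with hr
  have hrpos : 0 < r := Real.sqrt_pos.2 (by linarith)
  have hr2 : (n : ℝ) = r ^ 2 := (Real.sq_sqrt (by linarith)).symm
  have ht : 0 < A * r := by positivity
  have hspeed : speed (S : Set G) (lazyWalk S) n =
      (lazyOp S)^[n] (fun g => (wordLength (S : Set G) g : ℝ)) 1 :=
    (hasSum_convPow_lazyWalk S n _).tsum_eq
  have hle := hasSum_le (fun g => mul_le_mul_of_nonneg_left
      ((sq_div_sub_pow_four_div_le_abs (f g) ht).trans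
        (abs_le_mul_wordLength (S := (S : Set G)) hsym hgen hf hM g))
      (convPow_lazyWalk_nonneg S n g))
    (hasSum_convPow_lazyWalk S n _)
    (((hasSum_convPow_lazyWalk S n
      fun g => (wordLength (S : Set G) g : ℝ)).mul_left M).congr_fun
        fun g => mul_left_comm _ _ _)
  rw [iterate_lazyOp_quartic hSne hsym hf hv hm, ← hspeed] at hle
  have hmoment : (n : ℝ) * m + 3 * v ^ 2 * (n * (n - 1)) ≤ C * n ^ 2 := by
    have h1 : 0 ≤ m * (n * (n - 1)) := by
      have := sub_nonneg.2 hn1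
      positivity
    have h2 : 0 ≤ v ^ 2 * n := by positivity
    rw [hC]
    nlinarith
  rw [div_mul_eq_mul_div, div_le_iff₀' hMpos]
  refine le_trans ?_ hle
  have hfinal : (v * A ^ 2 - C) / A ^ 3 * r =
      n * (1 / (A * r) * v) - 1 / (A * r) ^ 3 * (C * n ^ 2) := by
    rw [hr2]
    field_simp
  have h := mul_le_mul_of_nonneg_left hmoment (by positivity : 0 ≤ 1 / (A * r) ^ 3)
  rw [hfinal]
  linarith
end
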